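/- arXiv:0801.4181 — 5 statements merged into one kernel-verified Lean document; each statement's English description precedes it below -/
import Mathlib

section
/- Let p be a prime and k ≥ 2 an integer. If k is not an integer power of p, then max_{0 ≤ j ≤ k−1} ν_p(C(k−1, j)) = ⌊log_p(k−1)⌋ − ν_p(k). If k is an integer power of p, then max_{0 ≤ j ≤ k−1} ν_p(C(k−1, j)) = 0. -/
theorem aux_nocarry (m a b : ℕ) (hm : 0 < m) (h : m ∣ a + b + 1) : ¬ m ≤ a % m + b % m := by
  intro hle
  have h1 := Nat.mod_lt a hm
  have h2 := Nat.mod_lt b hm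
  have h3 : m ∣ a % m + b % m + 1 := by
    have e : a + b + 1 = m * (a / m + b / m) + (a % m + b % m + 1) := by
      have := Nat.div_add_mod a m
      have := Nat.div_add_mod b m
      rw [mul_add]; omega
    rw [e] at h
    exact (Nat.dvd_add_right (Dvd.intro _ rfl)).1 h
  have h4 : m ∣ a % m + b % m + 1 - m := Nat.dvd_sub h3 dvd_rfl
  have := Nat.le_of_dvd (by omega) h4
  omega

theorem aux_upper (p k : ℕ) (hp : p.Prime) (hk : 2 ≤ k) (j : ℕ) (hj : j ∈ Finset.range k) :
    padicValNat p ((k - 1).choose j) ≤ Nat.log p (k - 1) - padicValNat p k := by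
  have := Fact.mk hp
  have hj' := Finset.mem_range.1 hj
  rw [padicValNat_choose (b := Nat.log p (k - 1) + 1) (by omega) (by omega)]
  calc _ ≤ (Finset.Ico (padicValNat p k + 1) (Nat.log p (k - 1) + 1)).card := by
        apply Finset.card_le_card
        intro i hi
        simp only [Finset.mem_filter, Finset.mem_Ico] at hi ⊢
        refine ⟨?_, hi.1.2⟩
        by_contra hc
        refine aux_nocarry (p ^ i) j (k - 1 - j) (pow_pos hp.pos i) ?_ hi.2
        have e : j + (k - 1 - j) + 1 = k := by omega
        rw [e]
        exact (pow_dvd_pow p (by omega)).trans pow_padicValNat_dvd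
    _ = _ := by simp

theorem aux_lower (p k : ℕ) (hp : p.Prime) (hk : 2 ≤ k) :
    Nat.log p (k - 1) - padicValNat p k ≤
      padicValNat p ((k - 1).choose (p ^ Nat.log p (k - 1) - 1)) := by
  have := Fact.mk hp
  have hL : p ^ Nat.log p (k - 1) ≤ k - 1 := Nat.pow_log_le_self p (by omega)
  rw [padicValNat_choose (b := Nat.log p (k - 1) + 1) (by omega) (by omega)]
  calc _ = (Finset.Ico (padicValNat p k + 1) (Nat.log p (k - 1) + 1)).card := by simp
    _ ≤ _ := by
        apply Finset.card_le_card
        intro i hi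
        simp only [Finset.mem_filter, Finset.mem_Ico] at hi ⊢
        refine ⟨by omega, ?_⟩
        have hpos : 0 < p ^ i := pow_pos hp.pos i
        have hLpos : 0 < p ^ Nat.log p (k - 1) := pow_pos hp.pos _
        have hd : p ^ i ∣ p ^ Nat.log p (k - 1) := pow_dvd_pow p (by omega)
        have h1 : (p ^ Nat.log p (k - 1) - 1) % p ^ i = p ^ i - 1 := by
          obtain ⟨c, hc⟩ := hd
          rw [hc] at hLpos ⊢
          have hc0 : 0 < c := Nat.pos_of_mul_pos_left hLpos
          obtain ⟨d, rfl⟩ : ∃ d, c = d + 1 := ⟨c - 1, by omega⟩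
          have : p ^ i * (d + 1) - 1 = p ^ i * d + (p ^ i - 1) := by rw [mul_add]; omega
          rw [this, Nat.mul_add_mod]
          exact Nat.mod_eq_of_lt (by omega)
        have h2 : (k - 1 - (p ^ Nat.log p (k - 1) - 1)) % p ^ i ≠ 0 := by
          intro h0
          have h3 := (Nat.dvd_add (Nat.dvd_of_mod_eq_zero h0) hd)
          have e : k - 1 - (p ^ Nat.log p (k - 1) - 1) + p ^ Nat.log p (k - 1) = k := by omega
          rw [e] at h3
          have := (padicValNat_dvd_iff_le (by omega)).1 h3
          omega
        rw [h1]
        have h4 := Nat.pos_of_ne_zero h2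
        generalize (k - 1 - (p ^ Nat.log p (k - 1) - 1)) % p ^ i = x at h4 ⊢
        omega

theorem stmt7 (p k : ℕ) (hp : p.Prime) (hk : 2 ≤ k) :
    ((¬ ∃ r : ℕ, k = p ^ r) →
      ((((Finset.range k).sup fun j => padicValNat p ((k - 1).choose j) : ℕ) : ℤ) =
        (Nat.log p (k - 1) : ℤ) - (padicValNat p k : ℤ))) ∧
    ((∃ r : ℕ, k = p ^ r) →
      ((Finset.range k).sup fun j => padicValNat p ((k - 1).choose j)) = 0) := by
  have := Fact.mk hp
  have hL : p ^ Nat.log p (k - 1) ≤ k - 1 := Nat.pow_log_le_self p (by omega)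
  have key : ((Finset.range k).sup fun j => padicValNat p ((k - 1).choose j)) =
      Nat.log p (k - 1) - padicValNat p k := by
    apply le_antisymm
    · exact Finset.sup_le (aux_upper p k hp hk)
    · exact (aux_lower p k hp hk).trans
        (Finset.le_sup (f := fun j => padicValNat p ((k - 1).choose j))
          (Finset.mem_range.2 (by omega)))
  rw [key]
  constructor
  · intro h
    have hd : p ^ padicValNat p k ∣ k := pow_padicValNat_dvd
    have hle := Nat.le_of_dvd (by omega) hd
    have hne : k ≠ p ^ padicValNat p k := fun e => h ⟨_, e⟩
    have : padicValNat p k ≤ Nat.log p (k - 1) :=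
      Nat.le_log_of_pow_le hp.one_lt (by omega)
    omega
  · rintro ⟨r, hr⟩
    have hv : padicValNat p k = r := by rw [hr, padicValNat.prime_pow]
    have : p ^ Nat.log p (k - 1) < p ^ r := by omega
    have := (Nat.pow_lt_pow_iff_right hp.one_lt).1 this
    omega
end

section
/- For every natural number n, ALLDIV_3(n) holds if and only if the residue of n modulo 36 lies in the set {0, 1, 9, 20, 28, 29}. -/
/-- `ALLDIV k n`: for every `1 ≤ j ≤ k`, `j!` divides `C(n, j)`. -/
def AllDiv (k n : ℕ) : Prop := ∀ j : ℕ, 1 ≤ j → j ≤ k → Nat.factorial j ∣ n.choose j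

theorem aux_iff (n : ℕ) :
    AllDiv 3 n ↔ 4 ∣ n.descFactorial 2 ∧ 36 ∣ n.descFactorial 3 := by
  have e2 := Nat.descFactorial_eq_factorial_mul_choose n 2
  have e3 := Nat.descFactorial_eq_factorial_mul_choose n 3
  have f2 : Nat.factorial 2 = 2 := rfl
  have f3 : Nat.factorial 3 = 6 := rfl
  rw [f2] at e2
  rw [f3] at e3
  constructor
  · intro h
    have h2 := h 2 (by norm_num) (by norm_num)
    have h3 := h 3 (by norm_num) (by norm_num)
    rw [f2] at h2
    rw [f3] at h3
    omega
  · rintro ⟨h2, h3⟩ j hj1 hj3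
    interval_cases j
    · simp
    · rw [f2]; omega
    · rw [f3]; omega

theorem aux_mod : ∀ r < 36, ((4 ∣ (r + 2) * (r + 1) ∧ 36 ∣ (r + 2) * (r + 1) * r) ↔
    ((r + 2) % 36 = 0 ∨ (r + 2) % 36 = 1 ∨ (r + 2) % 36 = 9 ∨ (r + 2) % 36 = 20 ∨
      (r + 2) % 36 = 28 ∨ (r + 2) % 36 = 29)) := by
  decide

theorem stmt10 (n : ℕ) :
    AllDiv 3 n ↔
      n % 36 = 0 ∨ n % 36 = 1 ∨ n % 36 = 9 ∨ n % 36 = 20 ∨ n % 36 = 28 ∨ n % 36 = 29 := by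
  rw [aux_iff]
  match n with
  | 0 => decide
  | 1 => decide
  | m + 2 =>
    have d2 : (m + 2).descFactorial 2 = (m + 2) * (m + 1) := by
      simp; ring
    have d3 : (m + 2).descFactorial 3 = (m + 2) * (m + 1) * m := by
      simp; ring
    rw [d2, d3]
    have hm : m % 36 ≡ m [MOD 36] := Nat.mod_modEq m 36
    have c36 : 36 ∣ (m % 36 + 2) * (m % 36 + 1) * (m % 36) ↔ 36 ∣ (m + 2) * (m + 1) * m :=
      (((hm.add_right 2).mul (hm.add_right 1)).mul hm).dvd_iff dvd_rfl
    have c4 : 4 ∣ (m % 36 + 2) * (m % 36 + 1) ↔ 4 ∣ (m + 2) * (m + 1) :=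
      ((hm.add_right 2).mul (hm.add_right 1)).dvd_iff (by norm_num)
    have key := aux_mod (m % 36) (Nat.mod_lt _ (by norm_num))
    rw [c36, c4, Nat.mod_add_mod] at key
    exact key
end

section
/- Let k ≥ 2 and let σ be a permutation of [n] with n ≥ k. If σ is k-symmetric, then σ is (k−1)-symmetric. -/
/-- `patternCount σ τ`: the number of occurrences of the pattern `τ ∈ S_k` in `σ ∈ S_n`,
i.e. the number of strictly increasing `f : Fin k → Fin n` such that `σ ∘ f` has order
type `τ`. -/
def patternCount {n k : ℕ} (σ : Equiv.Perm (Fin n)) (τ : Equiv.Perm (Fin k)) : ℕ :=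
  (Finset.univ.filter fun f : Fin k → Fin n =>
    (∀ a b : Fin k, a < b → f a < f b) ∧
    (∀ a b : Fin k, τ a < τ b ↔ σ (f a) < σ (f b))).card

/-- A permutation `σ` of `[n]` is `k`-symmetric if all patterns of length `k` occur
equally often in `σ`. -/
def IsKSymmetric {n : ℕ} (σ : Equiv.Perm (Fin n)) (k : ℕ) : Prop :=
  ∀ τ τ' : Equiv.Perm (Fin k), patternCount σ τ = patternCount σ τ'

theorem pat_exists {n k : ℕ} (u : Fin k → Fin n) (hu : Function.Injective u) :
    ∃ π : Equiv.Perm (Fin k), ∀ a b, π a < π b ↔ u a < u b := by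
  refine ⟨(Tuple.sort u)⁻¹, fun a b => ?_⟩
  have hm : StrictMono (u ∘ Tuple.sort u) :=
    (Tuple.monotone_sort u).strictMono_of_injective (hu.comp (Tuple.sort u).injective)
  have := hm.lt_iff_lt (a := (Tuple.sort u)⁻¹ a) (b := (Tuple.sort u)⁻¹ b)
  simpa using this.symm

theorem pat_unique {k : ℕ} (π π' : Equiv.Perm (Fin k))
    (h : ∀ a b, π a < π b ↔ π' a < π' b) : π = π' := by
  have hm : StrictMono (π' ∘ π.symm) := by
    intro a b hab
    have := h (π.symm a) (π.symm b)
    simp at this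
    exact this.1 hab
  have h2 : (π' ∘ π.symm) = id := by
    apply StrictMono.range_inj hm strictMono_id |>.1
    simp [Set.range_comp]
  ext a
  have := congrFun h2 (π a)
  simp at this
  rw [this]

theorem pos_unique {n m : ℕ} (g g' : Fin (m+1) → Fin n) (j j' : Fin (m+1))
    (hg : StrictMono g) (hg' : StrictMono g')
    (h1 : g ∘ j.succAbove = g' ∘ j'.succAbove) (h2 : g j = g' j') : g = g' ∧ j = j' := by
  have key : ∀ a : Fin m, a.castSucc < j ↔ a.castSucc < j' := by
    intro a
    rw [← Fin.succAbove_lt_iff_castSucc_lt, ← Fin.succAbove_lt_iff_castSucc_lt,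
      ← hg.lt_iff_lt, ← hg'.lt_iff_lt, h2]
    have := congrFun h1 a
    simp only [Function.comp] at this
    rw [this]
  have hj : j = j' := by
    rcases lt_trichotomy j j' with hlt | h | hlt
    · have hh := (key ⟨j.1, by omega⟩).2 hlt
      exact absurd hh (lt_irrefl _)
    · exact h
    · have hh := (key ⟨j'.1, by omega⟩).1 hlt
      exact absurd hh (lt_irrefl _)
  subst hj
  refine ⟨?_, rfl⟩
  funext x
  rcases Fin.eq_self_or_eq_succAbove j x with h | ⟨a, h⟩
  · rw [h, h2]
  · rw [h]; exact congrFun h1 a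

theorem pos_exists {n m : ℕ} (f : Fin m → Fin n) (hf : StrictMono f) (i : Fin n)
    (hi : i ∉ Set.range f) : ∃ (g : Fin (m+1) → Fin n) (j : Fin (m+1)),
      StrictMono g ∧ g ∘ j.succAbove = f ∧ g j = i := by
  classical
  have hi' : i ∉ Finset.univ.image f := by simpa using hi
  have hc : (insert i (Finset.univ.image f)).card = m + 1 := by
    rw [Finset.card_insert_of_notMem hi', Finset.card_image_of_injective _ hf.injective]
    simp
  set g := (insert i (Finset.univ.image f)).orderEmbOfFin hc with hgdef
  have hr : Set.range g = insert i (Set.range f) := by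
    rw [hgdef, Finset.range_orderEmbOfFin]; simp
  have : i ∈ Set.range g := by rw [hr]; simp
  obtain ⟨j, hj⟩ := this
  refine ⟨g, j, g.strictMono, ?_, hj⟩
  apply (StrictMono.range_inj (g.strictMono.comp (Fin.strictMono_succAbove j)) hf).1
  rw [Set.range_comp, Fin.range_succAbove, Set.image_compl_eq_range_sdiff_image g.injective, hr]
  simp [hj]
  intro x hx
  exact hi ⟨x, hx⟩

open Classical in
/-- pairs of a subsequence of length m+1 and a deleted place -/
noncomputable def pairCount {n m : ℕ} (σ : Equiv.Perm (Fin n)) (τ : Equiv.Perm (Fin m)) : ℕ :=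
  (Finset.univ.filter fun p : (Fin (m+1) → Fin n) × Fin (m+1) =>
    StrictMono p.1 ∧ ∀ a b, τ a < τ b ↔ σ (p.1 (p.2.succAbove a)) < σ (p.1 (p.2.succAbove b))).card

theorem pairCount_eq {n m : ℕ} (σ : Equiv.Perm (Fin n)) (τ : Equiv.Perm (Fin m)) :
    pairCount σ τ = patternCount σ τ * (n - m) := by
  classical
  have : pairCount σ τ = ((Finset.univ.filter fun f : Fin m → Fin n =>
    (∀ a b : Fin m, a < b → f a < f b) ∧
    (∀ a b : Fin m, τ a < τ b ↔ σ (f a) < σ (f b))).sigma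
      fun f => (Finset.univ.image f)ᶜ).card := by
    unfold pairCount
    apply Finset.card_bij (fun p _ => ⟨p.1 ∘ p.2.succAbove, p.1 p.2⟩)
    · rintro ⟨g, j⟩ hp
      simp only [Finset.mem_filter, Finset.mem_univ, true_and] at hp
      simp only [Finset.mem_sigma, Finset.mem_filter, Finset.mem_univ, true_and,
        Finset.mem_compl, Finset.mem_image, Function.comp, not_exists]
      refine ⟨⟨fun a b hab => hp.1 (Fin.strictMono_succAbove j hab), hp.2⟩, fun a ha => ?_⟩
      exact Fin.succAbove_ne j a (hp.1.injective ha)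
    · rintro ⟨g, j⟩ hp ⟨g', j'⟩ hp' heq
      simp only [Finset.mem_filter, Finset.mem_univ, true_and] at hp hp'
      simp only [Sigma.mk.injEq, heq_eq_eq] at heq
      obtain ⟨h1, h2⟩ := pos_unique g g' j j' hp.1 hp'.1 heq.1 heq.2
      rw [h1, h2]
    · rintro ⟨f, i⟩ hp
      simp only [Finset.mem_sigma, Finset.mem_filter, Finset.mem_univ, true_and,
        Finset.mem_compl, Finset.mem_image] at hp
      obtain ⟨g, j, hg, h1, h2⟩ := pos_exists f (fun a b hab => hp.1.1 a b hab) i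
        (by simpa using hp.2)
      refine ⟨(g, j), ?_, ?_⟩
      · simp only [Finset.mem_filter, Finset.mem_univ, true_and]
        refine ⟨hg, ?_⟩
        have := hp.1.2
        rw [← h1] at this
        exact this
      · simp [h1, h2]
  rw [this, Finset.card_sigma, Finset.sum_const_nat (m := n - m)]
  · rfl
  · intro f hf
    simp only [Finset.mem_filter, Finset.mem_univ, true_and] at hf
    have hs : StrictMono f := fun a b hab => hf.1 a b hab
    rw [Finset.card_compl, Finset.card_image_of_injective _ hs.injective]
    simp

open Classical in
/-- extensions of a pattern -/
noncomputable def extCount {m : ℕ} (τ : Equiv.Perm (Fin m)) (j : Fin (m+1)) : ℕ :=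
  (Finset.univ.filter fun π : Equiv.Perm (Fin (m+1)) =>
    ∀ a b, τ a < τ b ↔ π (j.succAbove a) < π (j.succAbove b)).card

theorem extCount_le {m : ℕ} (τ τ' : Equiv.Perm (Fin m)) (j : Fin (m+1)) :
    extCount τ j ≤ extCount τ' j := by
  classical
  unfold extCount
  obtain ⟨ρ, hρ⟩ : ∃ ρ : Equiv.Perm (Fin (m+1)),
      ∀ a, ρ (j.succAbove a) = j.succAbove (τ.symm (τ' a)) := by
    refine ⟨(finSuccEquiv' j).trans ((Equiv.optionCongr (τ'.trans τ.symm)).trans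
      (finSuccEquiv' j).symm), fun a => ?_⟩
    rw [Equiv.trans_apply, Equiv.trans_apply, finSuccEquiv'_succAbove, Equiv.optionCongr_apply,
      Option.map_some, finSuccEquiv'_symm_some]
    rfl
  apply Finset.card_le_card_of_injOn (fun π => π * ρ)
  · intro π hπ
    simp only [Finset.coe_filter, Finset.mem_univ, true_and, Set.mem_ofPred_eq] at hπ ⊢
    intro a b
    rw [Equiv.Perm.mul_apply, Equiv.Perm.mul_apply, hρ, hρ, ← hπ]
    simp
  · intro π _ π' _ h
    exact mul_right_cancel h

theorem pairCount_eq_sum {n m : ℕ} (σ : Equiv.Perm (Fin n)) (τ : Equiv.Perm (Fin m)) (c : ℕ)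
    (h : ∀ π : Equiv.Perm (Fin (m+1)), patternCount σ π = c) :
    pairCount σ τ = (∑ j, extCount τ j) * c := by
  classical
  have : pairCount σ τ = (((Finset.univ : Finset (Fin (m+1))).sigma fun j =>
      (Finset.univ.filter fun π : Equiv.Perm (Fin (m+1)) =>
        ∀ a b, τ a < τ b ↔ π (j.succAbove a) < π (j.succAbove b))).sigma fun q =>
      (Finset.univ.filter fun f : Fin (m+1) → Fin n =>
        (∀ a b : Fin (m+1), a < b → f a < f b) ∧
        (∀ a b : Fin (m+1), q.2 a < q.2 b ↔ σ (f a) < σ (f b)))).card := by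
    unfold pairCount
    symm
    apply Finset.card_bij (fun q _ => (q.2, q.1.1))
    · rintro ⟨⟨j, π⟩, g⟩ hq
      simp only [Finset.mem_sigma, Finset.mem_filter, Finset.mem_univ, true_and] at hq ⊢
      refine ⟨fun a b hab => hq.2.1 a b hab, fun a b => ?_⟩
      rw [hq.1, hq.2.2]
    · rintro ⟨⟨j, π⟩, g⟩ hq ⟨⟨j', π'⟩, g'⟩ hq' heq
      simp only [Finset.mem_sigma, Finset.mem_filter, Finset.mem_univ, true_and] at hq hq'
      simp only [Prod.mk.injEq] at heq
      obtain ⟨rfl, rfl⟩ := heq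
      have : π = π' := pat_unique _ _ fun a b => by rw [hq.2.2, hq'.2.2]
      rw [this]
    · rintro ⟨g, j⟩ hp
      simp only [Finset.mem_filter, Finset.mem_univ, true_and] at hp
      obtain ⟨π, hπ⟩ := pat_exists (fun a => σ (g a)) (σ.injective.comp hp.1.injective)
      refine ⟨⟨⟨j, π⟩, g⟩, ?_, rfl⟩
      simp only [Finset.mem_sigma, Finset.mem_filter, Finset.mem_univ, true_and]
      refine ⟨fun a b => ?_, fun a b hab => hp.1 hab, hπ⟩
      rw [hp.2, hπ]
  rw [this, Finset.card_sigma, Finset.sum_const_nat (m := c), Finset.card_sigma]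
  · rfl
  · rintro ⟨j, π⟩ _
    exact h π

theorem stmt12 {n k : ℕ} (hk : 2 ≤ k) (hn : k ≤ n) (σ : Equiv.Perm (Fin n))
    (h : IsKSymmetric σ k) : IsKSymmetric σ (k - 1) := by
  obtain ⟨m, rfl⟩ : ∃ m, k = m + 1 := ⟨k - 1, by omega⟩
  simp only [Nat.add_sub_cancel]
  intro τ τ'
  have e : ∀ τ : Equiv.Perm (Fin m), pairCount σ τ = (∑ j, extCount τ j) * patternCount σ 1 :=
    fun τ => pairCount_eq_sum σ τ _ fun π => h π 1
  have e2 : pairCount σ τ = pairCount σ τ' := by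
    rw [e, e, Finset.sum_congr rfl fun j _ => le_antisymm (extCount_le τ τ' j) (extCount_le τ' τ j)]
  rw [pairCount_eq, pairCount_eq] at e2
  exact Nat.eq_of_mul_eq_mul_right (by omega) e2
end

section
/- A permutation σ of [9] is nontrivially 3-symmetric (i.e., X^τ(σ) = 14 for every τ ∈ S_3) if and only if σ is one of the two permutations with one-line notation 349852167 and 761258943. Moreover, these two permutations are inverses of each other. -/
/-- Build a permutation of `Fin n` from (0-indexed) one-line notation. -/
noncomputable def permOfFun {n : ℕ} (v : Fin n → Fin n) (h : Function.Bijective v := by decide) :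
    Equiv.Perm (Fin n) := Equiv.ofBijective v h

/-- The permutation of `[9]` with one-line notation `349852167`. -/
noncomputable def sigma1 : Equiv.Perm (Fin 9) := permOfFun ![2, 3, 8, 7, 4, 1, 0, 5, 6]

/-- The permutation of `[9]` with one-line notation `761258943`. -/
noncomputable def sigma2 : Equiv.Perm (Fin 9) := permOfFun ![6, 5, 0, 1, 4, 7, 8, 3, 2]


def pInd (P : Prop) [Decidable P] : ℕ := if P then 1 else 0

theorem pc_eq (σ : Equiv.Perm (Fin 9)) (τ : Equiv.Perm (Fin 3)) :
    patternCount σ τ = ∑ i : Fin 9, ∑ j : Fin 9, ∑ k : Fin 9,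
      pInd (i < j ∧ j < k ∧ (τ 0 < τ 1 ↔ σ i < σ j) ∧ (τ 0 < τ 2 ↔ σ i < σ k) ∧
        (τ 1 < τ 2 ↔ σ j < σ k)) := by
  unfold patternCount pInd
  rw [Finset.card_filter]
  let e : (Fin 3 → Fin 9) ≃ Fin 9 × Fin 9 × Fin 9 :=
    { toFun := fun f => (f 0, f 1, f 2)
      invFun := fun x => ![x.1, x.2.1, x.2.2]
      left_inv := by intro f; ext i; fin_cases i <;> rfl
      right_inv := by intro x; rfl }
  have h : ∀ F : Fin 9 × Fin 9 × Fin 9 → ℕ,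
      ∑ x, F x = ∑ i, ∑ j, ∑ k, F (i, j, k) := by
    intro F; simp only [Fintype.sum_prod_type]
  refine Eq.trans ?_ (h fun x => if (x.1 < x.2.1 ∧ x.2.1 < x.2.2 ∧
      (τ 0 < τ 1 ↔ σ x.1 < σ x.2.1) ∧
      (τ 0 < τ 2 ↔ σ x.1 < σ x.2.2) ∧ (τ 1 < τ 2 ↔ σ x.2.1 < σ x.2.2)) then 1 else 0)
  refine Fintype.sum_equiv e _ _ fun f => ?_
  refine if_congr ?_ rfl rfl
  change _ ↔ (f 0 < f 1 ∧ f 1 < f 2 ∧ (τ 0 < τ 1 ↔ σ (f 0) < σ (f 1)) ∧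
      (τ 0 < τ 2 ↔ σ (f 0) < σ (f 2)) ∧ (τ 1 < τ 2 ↔ σ (f 1) < σ (f 2)))
  constructor
  · rintro ⟨h1, h2⟩
    exact ⟨h1 0 1 (by decide), h1 1 2 (by decide), h2 0 1, h2 0 2, h2 1 2⟩
  · rintro ⟨h1, h2, h3, h4, h5⟩
    have h6 := h1.trans h2
    have t1 : τ 0 ≠ τ 1 := τ.injective.ne (by decide)
    have t2 : τ 0 ≠ τ 2 := τ.injective.ne (by decide)
    have t3 : τ 1 ≠ τ 2 := τ.injective.ne (by decide)
    have s1 := σ.injective.ne h1.ne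
    have s2 := σ.injective.ne h2.ne
    have s3 := σ.injective.ne h6.ne
    refine ⟨?_, ?_⟩
    · simp [Fin.forall_fin_succ, h1, h2, h6]
    · simp only [Fin.forall_fin_succ, Fin.succ_zero_eq_one, Fin.succ_one_eq_two,
        IsEmpty.forall_iff, and_true, lt_irrefl, true_and]
      refine ⟨⟨?_, ?_⟩, ⟨?_, ?_⟩, ⟨?_, ?_⟩⟩ <;> grind

/-- contribution data -/
def cost (q p v a : ℕ) : ℕ :=
  match q with
  | 0 => a * (8 + a - p - v)
  | 1 => (p - a) * (v - a)
  | 2 => a * (v - a)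
  | 3 => (p - a) * (8 + a - p - v)
  | 4 => a * (p - a)
  | 5 => (v - a) * (8 + a - p - v)
  | 6 => a * (a - 1)
  | 7 => (p - a) * (p - a - 1)
  | 8 => (v - a) * (v - a - 1)
  | _ => (8 + a - p - v) * (8 + a - p - v - 1)

def bnds : List ℕ := [14, 14, 28, 28, 28, 28, 56, 56, 56, 56]

def cnt (v : ℕ) : List ℕ → ℕ
  | [] => 0
  | x :: l => cnt v l + (if x < v then 1 else 0)

def tot (q : ℕ) : List ℕ → ℕ
  | [] => 0
  | v :: l => tot q l + cost q l.length v (cnt v l)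

def okl (l : List ℕ) : ℕ → List ℕ → Bool
  | _, [] => true
  | q, b :: bs => bif Nat.ble (tot q l) b then okl l (q+1) bs else false

def good (l : List ℕ) : Bool :=
  l == [6, 5, 0, 1, 4, 7, 8, 3, 2] || l == [2, 3, 8, 7, 4, 1, 0, 5, 6]

def srch : ℕ → List ℕ → Bool
  | 0, l => good l
  | n+1, l => [0,1,2,3,4,5,6,7,8].all fun v =>
      bif l.contains v then true else (bif okl (v :: l) 0 bnds then srch n (v :: l) else true)

set_option maxRecDepth 100000 in
theorem srch_ok : srch 9 [] = true := by decide +kernel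

theorem s2inv : sigma2 = sigma1⁻¹ := by
  rw [eq_inv_iff_mul_eq_one]
  ext x
  fin_cases x <;> rfl

theorem s1cnt : ∀ τ : Equiv.Perm (Fin 3), patternCount sigma1 τ = 14 := by
  intro τ; rw [pc_eq]; revert τ
  decide +kernel

theorem s2cnt : ∀ τ : Equiv.Perm (Fin 3), patternCount sigma2 τ = 14 := by
  intro τ; rw [pc_eq]; revert τ
  decide +kernel

section
variable (σ : Equiv.Perm (Fin 9))

def T (c1 c2 c3 : Bool) (i j k : Fin 9) : ℕ :=
  pInd (i < j ∧ j < k ∧ (c1 = true ↔ σ i < σ j) ∧ (c2 = true ↔ σ i < σ k) ∧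
    (c3 = true ↔ σ j < σ k))

theorem T_sum (h : ∀ τ : Equiv.Perm (Fin 3), patternCount σ τ = 14) (c1 c2 c3 : Bool)
    (hc : (c1 = c3 → c2 = c1)) :
    ∑ i : Fin 9, ∑ j : Fin 9, ∑ k : Fin 9, T σ c1 c2 c3 i j k = 14 := by
  have key : ∀ c1 c2 c3 : Bool, (c1 = c3 → c2 = c1) → ∃ τ : Equiv.Perm (Fin 3),
    (τ 0 < τ 1 ↔ c1 = true) ∧ (τ 0 < τ 2 ↔ c2 = true) ∧ (τ 1 < τ 2 ↔ c3 = true) := by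
    decide +kernel
  obtain ⟨τ, h1, h2, h3⟩ := key c1 c2 c3 hc
  have := h τ
  rw [pc_eq] at this
  simp only [h1, h2, h3] at this
  exact this

def LS (j : Fin 9) : ℕ := ∑ i : Fin 9, pInd (i < j ∧ σ i < σ j)
def LB (j : Fin 9) : ℕ := ∑ i : Fin 9, pInd (i < j ∧ σ j < σ i)
def RS (j : Fin 9) : ℕ := ∑ i : Fin 9, pInd (j < i ∧ σ i < σ j)
def RB (j : Fin 9) : ℕ := ∑ i : Fin 9, pInd (j < i ∧ σ j < σ i)

theorem ne_of (i j : Fin 9) (h : σ i = σ j) : i = j := σ.injective h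

theorem cnt_lt : ∀ j : Fin 9, ∑ i : Fin 9, pInd (i < j) = j := by decide +kernel

theorem sL (j : Fin 9) : LS σ j + LB σ j = j := by
  rw [← cnt_lt j, LS, LB, ← Finset.sum_add_distrib]
  refine Finset.sum_congr rfl fun i _ => ?_
  have := ne_of σ i j
  unfold pInd
  grind

theorem sS (j : Fin 9) : LS σ j + RS σ j = σ j := by
  rw [← cnt_lt (σ j), ← Equiv.sum_comp σ, LS, RS, ← Finset.sum_add_distrib]
  refine Finset.sum_congr rfl fun i _ => ?_
  have := ne_of σ i j
  unfold pInd
  grind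

theorem sA (j : Fin 9) : LS σ j + LB σ j + RS σ j + RB σ j = 8 := by
  have h8 : ∀ j : Fin 9, ∑ i : Fin 9, pInd (i ≠ j) = 8 := by decide +kernel
  rw [← h8 j, LS, LB, RS, RB, ← Finset.sum_add_distrib, ← Finset.sum_add_distrib,
    ← Finset.sum_add_distrib]
  refine Finset.sum_congr rfl fun i _ => ?_
  have := ne_of σ i j
  unfold pInd
  grind

theorem tri (h : Fin 9 → Fin 9 → ℕ) : ∑ i, ∑ j, h i j =
    (∑ i, ∑ j, pInd (i < j) * (h i j + h j i)) + ∑ i, h i i := by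
  have h1 : ∀ i j, h i j = pInd (i < j) * h i j + pInd (j < i) * h i j + pInd (i = j) * h i j := by
    intro i j; unfold pInd; grind
  have h2 : ∑ i, ∑ j, pInd (j < i) * h i j = ∑ i, ∑ j, pInd (i < j) * h j i := Finset.sum_comm
  have h3 : ∑ i, ∑ j, pInd (i = j) * h i j = ∑ i, h i i := by
    simp [pInd]
  calc _ = ∑ i, ∑ j, (pInd (i < j) * h i j + pInd (j < i) * h i j + pInd (i = j) * h i j) :=
        Finset.sum_congr rfl fun i _ => Finset.sum_congr rfl fun j _ => h1 i j
    _ = _ := by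
      simp only [Finset.sum_add_distrib, mul_add]
      rw [h2, h3]


theorem mid_sum (f g : Fin 9 → Fin 9 → ℕ) :
    ∑ j, (∑ i, f i j) * (∑ k, g k j) = ∑ i, ∑ j, ∑ k, f i j * g k j := by
  simp only [Finset.sum_mul_sum]
  exact Finset.sum_comm

theorem last_sum (f g : Fin 9 → Fin 9 → ℕ) :
    ∑ k, (∑ i, f i k) * (∑ j, g j k) =
      (∑ i, ∑ j, ∑ k, pInd (i < j) * (f i k * g j k + f j k * g i k)) +
        ∑ k, ∑ i, f i k * g i k := by
  simp only [Finset.sum_mul_sum]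
  rw [Finset.sum_congr rfl fun k _ => tri fun i j => f i k * g j k, Finset.sum_add_distrib]
  have e : ∀ G : Fin 9 → Fin 9 → Fin 9 → ℕ,
      ∑ k, ∑ i, ∑ j, G i j k = ∑ i, ∑ j, ∑ k, G i j k := by
    intro G
    rw [Finset.sum_comm]
    exact Finset.sum_congr rfl fun i _ => Finset.sum_comm
  rw [e fun i j k => pInd (i < j) * (f i k * g j k + f j k * g i k)]

theorem first_sum (f g : Fin 9 → Fin 9 → ℕ) :
    ∑ i, (∑ j, f j i) * (∑ k, g k i) =
      (∑ i, ∑ j, ∑ k, pInd (j < k) * (f j i * g k i + f k i * g j i)) +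
        ∑ i, ∑ j, f j i * g j i := by
  simp only [Finset.sum_mul_sum]
  rw [Finset.sum_congr rfl fun k _ => tri fun i j => f i k * g j k, Finset.sum_add_distrib]

theorem congr3 {F G : Fin 9 → Fin 9 → Fin 9 → ℕ} (h : ∀ i j k, F i j k = G i j k) :
    ∑ i, ∑ j, ∑ k, F i j k = ∑ i, ∑ j, ∑ k, G i j k := by
  simp only [h]

theorem sq_aux (n : Fin 9 → ℕ) (c : ℕ) (h : ∑ i, n i * n i = c + ∑ i, n i) :
    ∑ i, n i * (n i - 1) = c := by
  have : ∑ i, n i * n i = ∑ i, n i * (n i - 1) + ∑ i, n i := by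
    rw [← Finset.sum_add_distrib]
    refine Finset.sum_congr rfl fun i _ => ?_
    cases n i
    · rfl
    · simp; ring
  omega

theorem pInd_sq (P : Prop) [Decidable P] : pInd P * pInd P = pInd P := by
  unfold pInd; split_ifs <;> rfl

theorem pInd_mul (P Q : Prop) [Decidable P] [Decidable Q] :
    pInd P * pInd Q = pInd (P ∧ Q) := by
  unfold pInd; grind

variable (h : ∀ τ : Equiv.Perm (Fin 3), patternCount σ τ = 14)
include h

theorem b0 : ∑ j, LS σ j * RB σ j = 14 := by
  unfold LS RB
  rw [mid_sum, ← T_sum σ h true true true (by decide)]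
  refine congr3 fun i j k => ?_
  unfold T pInd
  grind

theorem b1 : ∑ j, LB σ j * RS σ j = 14 := by
  unfold LB RS
  rw [mid_sum, ← T_sum σ h false false false (by decide)]
  refine congr3 fun i j k => ?_
  have := ne_of σ i j
  have := ne_of σ j k
  unfold T pInd
  grind

theorem two (c1 c2 c3 d1 d2 d3 : Bool) (hc : (c1 = c3 → c2 = c1)) (hd : (d1 = d3 → d2 = d1)) :
    ∑ i, ∑ j, ∑ k, (T σ c1 c2 c3 i j k + T σ d1 d2 d3 i j k) = 28 := by
  simp only [Finset.sum_add_distrib]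
  rw [T_sum σ h c1 c2 c3 hc, T_sum σ h d1 d2 d3 hd]

theorem two' (c1 c2 c3 d1 d2 d3 : Bool) (hc : (c1 = c3 → c2 = c1)) (hd : (d1 = d3 → d2 = d1)) :
    ∑ i, ∑ j, ∑ k, (2 * (T σ c1 c2 c3 i j k + T σ d1 d2 d3 i j k)) = 56 := by
  simp only [← Finset.mul_sum]
  rw [two σ h _ _ _ _ _ _ hc hd]
  norm_num

theorem b2 : ∑ j, LS σ j * RS σ j = 28 := by
  unfold LS RS
  rw [mid_sum, ← two σ h true true false true false false (by decide) (by decide)]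
  refine congr3 fun i j k => ?_
  have := ne_of σ i j
  have := ne_of σ j k
  have := ne_of σ i k
  unfold T pInd
  grind

theorem b3 : ∑ j, LB σ j * RB σ j = 28 := by
  unfold LB RB
  rw [mid_sum, ← two σ h false true true false false true (by decide) (by decide)]
  refine congr3 fun i j k => ?_
  have := ne_of σ i j
  have := ne_of σ j k
  have := ne_of σ i k
  unfold T pInd
  grind

theorem b4 : ∑ j, LS σ j * LB σ j = 28 := by
  unfold LS LB
  rw [last_sum, ← two σ h true true false false false true (by decide) (by decide)]
  have h0 : ∑ k : Fin 9, ∑ i : Fin 9, pInd (i < k ∧ σ i < σ k) * pInd (i < k ∧ σ k < σ i) = 0 := by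
    refine Finset.sum_eq_zero fun k _ => Finset.sum_eq_zero fun i _ => ?_
    unfold pInd
    grind
  rw [h0, add_zero]
  refine congr3 fun i j k => ?_
  have := ne_of σ i j
  have := ne_of σ j k
  have := ne_of σ i k
  unfold T pInd
  grind

theorem b5 : ∑ j, RS σ j * RB σ j = 28 := by
  unfold RS RB
  rw [first_sum, ← two σ h false true true true false false (by decide) (by decide)]
  have h0 : ∑ k : Fin 9, ∑ i : Fin 9, pInd (k < i ∧ σ i < σ k) * pInd (k < i ∧ σ k < σ i) = 0 := by
    refine Finset.sum_eq_zero fun k _ => Finset.sum_eq_zero fun i _ => ?_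
    unfold pInd
    grind
  rw [h0, add_zero]
  refine congr3 fun i j k => ?_
  have := ne_of σ i j
  have := ne_of σ j k
  have := ne_of σ i k
  unfold T pInd
  grind

theorem b6 : ∑ j, LS σ j * (LS σ j - 1) = 56 := by
  apply sq_aux
  unfold LS
  rw [last_sum, ← two' σ h true true true false true true (by decide) (by decide)]
  simp only [pInd_sq]
  rw [Nat.add_right_cancel_iff]
  refine congr3 fun i j k => ?_
  have := ne_of σ i j
  have := ne_of σ j k
  have := ne_of σ i k
  unfold T pInd
  grind

theorem b7 : ∑ j, LB σ j * (LB σ j - 1) = 56 := by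
  apply sq_aux
  unfold LB
  rw [last_sum, ← two' σ h false false false true false false (by decide) (by decide)]
  simp only [pInd_sq]
  rw [Nat.add_right_cancel_iff]
  refine congr3 fun i j k => ?_
  have := ne_of σ i j
  have := ne_of σ j k
  have := ne_of σ i k
  unfold T pInd
  grind

theorem b8 : ∑ j, RS σ j * (RS σ j - 1) = 56 := by
  apply sq_aux
  unfold RS
  rw [first_sum, ← two' σ h false false false false false true (by decide) (by decide)]
  simp only [pInd_sq]
  rw [Nat.add_right_cancel_iff]
  refine congr3 fun i j k => ?_
  have := ne_of σ i j
  have := ne_of σ j k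
  have := ne_of σ i k
  unfold T pInd
  grind

theorem b9 : ∑ j, RB σ j * (RB σ j - 1) = 56 := by
  apply sq_aux
  unfold RB
  rw [first_sum, ← two' σ h true true true true true false (by decide) (by decide)]
  simp only [pInd_sq]
  rw [Nat.add_right_cancel_iff]
  refine congr3 fun i j k => ?_
  have := ne_of σ i j
  have := ne_of σ j k
  have := ne_of σ i k
  unfold T pInd
  grind

omit h

def sv (j : ℕ) : ℕ := if h : j < 9 then σ ⟨j, h⟩ else 0

def pre : ℕ → List ℕ
  | 0 => []
  | p+1 => sv σ p :: pre p

theorem pre_len (p : ℕ) : (pre σ p).length = p := by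
  induction p with
  | zero => rfl
  | succ p ih => simp [pre, ih]

theorem cnt_pre (j : Fin 9) : cnt (sv σ j) (pre σ j) = LS σ j := by
  have hs : ∀ i : Fin 9, sv σ i = σ i := by intro i; simp [sv]
  have key : ∀ v p, cnt v (pre σ p) = ∑ i ∈ Finset.range p, pInd (sv σ i < v) := by
    intro v p
    induction p with
    | zero => rfl
    | succ p ih => rw [Finset.sum_range_succ, ← ih]; rfl
  have h1 : LS σ j = ∑ i ∈ Finset.range 9, pInd (i < (j : ℕ) ∧ sv σ i < sv σ j) := by
    rw [← Fin.sum_univ_eq_sum_range (fun i => pInd (i < (j : ℕ) ∧ sv σ i < sv σ j)) 9]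
    unfold LS
    simp only [hs]
    rfl
  rw [key, h1]
  have hj : Finset.range j ⊆ Finset.range 9 := by
    intro x; have := j.2; simp only [Finset.mem_range]; omega
  rw [← Finset.sum_subset hj]
  · refine Finset.sum_congr rfl fun i hi => ?_
    have := Finset.mem_range.1 hi
    simp [this]
  · intro i _ hi
    have : ¬ i < (j : ℕ) := by simpa using hi
    simp [pInd, this]

theorem tot_pre (q : ℕ) : tot q (pre σ 9) = ∑ j : Fin 9, cost q j (σ j) (LS σ j) := by
  have key : ∀ p, tot q (pre σ p) =
      ∑ j ∈ Finset.range p, cost q j (sv σ j) (cnt (sv σ j) (pre σ j)) := by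
    intro p
    induction p with
    | zero => rfl
    | succ p ih => rw [Finset.sum_range_succ, ← ih]; simp [pre, tot, pre_len]
  rw [key, ← Fin.sum_univ_eq_sum_range
    (fun j => cost q j (sv σ j) (cnt (sv σ j) (pre σ j))) 9]
  refine Finset.sum_congr rfl fun j _ => ?_
  rw [cnt_pre]
  simp [sv]

theorem tot_mono (q p : ℕ) (hp : p ≤ 9) : tot q (pre σ p) ≤ tot q (pre σ 9) := by
  have : Monotone fun p => tot q (pre σ p) := by
    refine monotone_nat_of_le_succ fun p => ?_
    simp [pre, tot]
  exact this hp

theorem mem_pre (p x : ℕ) : x ∈ pre σ p ↔ ∃ i < p, sv σ i = x := by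
  induction p with
  | zero => simp [pre]
  | succ p ih =>
    simp only [pre, List.mem_cons, ih]
    constructor
    · rintro (h | ⟨i, hi, h⟩)
      · exact ⟨p, by omega, h.symm⟩
      · exact ⟨i, by omega, h⟩
    · rintro ⟨i, hi, h⟩
      rcases Nat.lt_succ_iff_lt_or_eq.1 hi with h' | h'
      · exact Or.inr ⟨i, h', h⟩
      · subst h'; exact Or.inl h.symm

theorem not_mem_pre (p : ℕ) (hp : p < 9) : sv σ p ∉ pre σ p := by
  rw [mem_pre]
  rintro ⟨i, hi, h⟩
  have hi9 : i < 9 := by omega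
  simp only [sv, hp, hi9, dif_pos] at h
  have := σ.injective (Fin.ext h)
  simp at this
  omega

include h

theorem bound_all : tot 0 (pre σ 9) = 14 ∧ tot 1 (pre σ 9) = 14 ∧ tot 2 (pre σ 9) = 28 ∧
    tot 3 (pre σ 9) = 28 ∧ tot 4 (pre σ 9) = 28 ∧ tot 5 (pre σ 9) = 28 ∧ tot 6 (pre σ 9) = 56 ∧
    tot 7 (pre σ 9) = 56 ∧ tot 8 (pre σ 9) = 56 ∧ tot 9 (pre σ 9) = 56 := by
  have e1 : ∀ j : Fin 9, (j : ℕ) - LS σ j = LB σ j := by intro j; have := sL σ j; omega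
  have e2 : ∀ j : Fin 9, (σ j : ℕ) - LS σ j = RS σ j := by intro j; have := sS σ j; omega
  have e3 : ∀ j : Fin 9, 8 + LS σ j - (j : ℕ) - (σ j : ℕ) = RB σ j := by
    intro j; have := sL σ j; have := sS σ j; have := sA σ j; omega
  simp only [tot_pre, cost, e1, e2, e3]
  exact ⟨b0 σ h, b1 σ h, b2 σ h, b3 σ h, b4 σ h, b5 σ h, b6 σ h, b7 σ h, b8 σ h, b9 σ h⟩

theorem okl_pre (p : ℕ) (hp : p ≤ 9) : okl (pre σ p) 0 bnds = true := by
  obtain ⟨h0, h1, h2, h3, h4, h5, h6, h7, h8, h9⟩ := bound_all σ h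
  have m := fun q => tot_mono σ q p hp
  have k : ∀ q b, tot q (pre σ 9) = b → Nat.ble (tot q (pre σ p)) b = true := by
    intro q b hb; rw [Nat.ble_eq, ← hb]; exact m q
  simp [okl, bnds, k 0 _ h0, k 1 _ h1, k 2 _ h2, k 3 _ h3, k 4 _ h4, k 5 _ h5, k 6 _ h6,
    k 7 _ h7, k 8 _ h8, k 9 _ h9]

theorem good_pre : good (pre σ 9) = true := by
  have key : ∀ n p, n + p = 9 → srch n (pre σ p) = true → good (pre σ 9) = true := by
    intro n
    induction n with
    | zero => intro p hp hs; obtain rfl : p = 9 := by omega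
              exact hs
    | succ n ih =>
      intro p hp hs
      refine ih (p+1) (by omega) ?_
      rw [srch, List.all_eq_true] at hs
      have hv : sv σ p ∈ [0,1,2,3,4,5,6,7,8] := by
        have : sv σ p < 9 := by
          unfold sv; split_ifs
          · exact Fin.isLt _
          · omega
        interval_cases sv σ p <;> simp
      have := hs _ hv
      have hn : (pre σ p).contains (sv σ p) = false := by
        simpa using not_mem_pre σ p (by omega)
      have ho := okl_pre σ h (p+1) (by omega)
      rw [pre] at ho
      rw [hn, ho] at this
      exact this
  exact key 9 0 rfl srch_ok

theorem concl : σ = sigma1 ∨ σ = sigma2 := by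
  have := good_pre σ h
  simp only [good, Bool.or_eq_true, beq_iff_eq, pre, sv, List.cons.injEq] at this
  rcases this with h | h
  · left
    ext x
    fin_cases x <;> simp_all <;> rfl
  · right
    ext x
    fin_cases x <;> simp_all <;> rfl

end

theorem stmt13 :
    (∀ σ : Equiv.Perm (Fin 9),
      ((∀ τ : Equiv.Perm (Fin 3), patternCount σ τ = 14) ↔ (σ = sigma1 ∨ σ = sigma2))) ∧
    sigma2 = sigma1⁻¹ := by
  refine ⟨fun σ => ⟨concl σ, ?_⟩, s2inv⟩
  rintro (rfl | rfl)
  · exact s1cnt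
  · exact s2cnt
end

section
/- Let m be fixed and σ a permutation of m symbols. If σ ⊗ ρ_n is asymptotically 2-symmetric (where ρ_n is a uniformly random permutation of n symbols and convergence is in probability as n → ∞), then σ is 2-symmetric, i.e., X^{(12)}(σ) = X^{(21)}(σ) = m(m−1)/4. -/
/-- The tensor (Kronecker) product of permutations: for `σ ∈ S_a`, `ρ ∈ S_b`,
`(σ ⊗ ρ)(j) = b·σ(⌊j/b⌋) + ρ(j mod b)` on `{0, …, ab−1}`. -/
def tensorPerm {a b : ℕ} (σ : Equiv.Perm (Fin a)) (ρ : Equiv.Perm (Fin b)) :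
    Equiv.Perm (Fin (a * b)) :=
  (finProdFinEquiv.symm.trans (σ.prodCongr ρ)).trans finProdFinEquiv

open scoped Classical in
/-- `σ ∈ S_m` is `k`-inflatable: `σ ⊗ ρ_n` (with `ρ_n` a uniformly random permutation of
`n` symbols) is asymptotically `k`-symmetric, i.e. the sizes `m·n` tend to infinity and,
for every pattern `τ ∈ S_k`, `k!² · X^τ(σ ⊗ ρ_n) / (mn)^k → 1` in probability
(the probability is the proportion of permutations `ρ ∈ S_n` violating the
`ε`-approximation, which must tend to `0`). -/
noncomputable def IsKInflatable {m : ℕ} (σ : Equiv.Perm (Fin m)) (k : ℕ) : Prop :=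
  Filter.Tendsto (fun n : ℕ => m * n) Filter.atTop Filter.atTop ∧
  ∀ τ : Equiv.Perm (Fin k), ∀ ε : ℝ, 0 < ε →
    Filter.Tendsto (fun n : ℕ =>
      ((Finset.univ.filter fun ρ : Equiv.Perm (Fin n) =>
          ε < |(Nat.factorial k : ℝ) ^ 2 * (patternCount (tensorPerm σ ρ) τ : ℝ) /
              ((m * n : ℕ) : ℝ) ^ k - 1|).card : ℝ) /
        (Fintype.card (Equiv.Perm (Fin n)) : ℝ))
      Filter.atTop (nhds 0)

def ascC {n : ℕ} (σ : Equiv.Perm (Fin n)) : ℕ :=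
  ∑ a : Fin n, ∑ b : Fin n, if a < b ∧ σ a < σ b then 1 else 0

def descC {n : ℕ} (σ : Equiv.Perm (Fin n)) : ℕ :=
  ∑ a : Fin n, ∑ b : Fin n, if a < b ∧ σ b < σ a then 1 else 0

theorem patternCount_refl_eq {n : ℕ} (σ : Equiv.Perm (Fin n)) :
    patternCount σ (Equiv.refl (Fin 2)) = ascC σ := by
  unfold patternCount ascC
  rw [Finset.card_filter, ← (finTwoArrowEquiv (Fin n)).symm.sum_comp, Fintype.sum_prod_type]
  refine Finset.sum_congr rfl fun a _ => Finset.sum_congr rfl fun b _ => ?_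
  refine if_congr ?_ rfl rfl
  simp [Fin.forall_fin_two]
  intro h1 h2
  exact h2.le

theorem patternCount_swap_eq {n : ℕ} (σ : Equiv.Perm (Fin n)) :
    patternCount σ (Equiv.swap (0 : Fin 2) 1) = descC σ := by
  unfold patternCount descC
  rw [Finset.card_filter, ← (finTwoArrowEquiv (Fin n)).symm.sum_comp, Fintype.sum_prod_type]
  refine Finset.sum_congr rfl fun a _ => Finset.sum_congr rfl fun b _ => ?_
  refine if_congr ?_ rfl rfl
  simp [Fin.forall_fin_two]
  intro h1 h2
  exact h2.le

theorem ascC_add_descC {n : ℕ} (σ : Equiv.Perm (Fin n)) :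
    (ascC σ + descC σ) * 2 = n * (n - 1) := by
  rw [← Finset.sum_range_id_mul_two, ← Fin.sum_univ_eq_sum_range (fun i => i)]
  congr 1
  unfold ascC descC
  rw [← Finset.sum_add_distrib]
  simp_rw [← Finset.sum_add_distrib]
  rw [Finset.sum_comm]
  refine Finset.sum_congr rfl fun b _ => ?_
  have : ∀ a : Fin n, ((if a < b ∧ σ a < σ b then 1 else 0) +
      (if a < b ∧ σ b < σ a then 1 else 0) : ℕ) = if a < b then 1 else 0 := by
    intro a
    by_cases hab : a < b
    · have : σ a ≠ σ b := fun h => hab.ne (σ.injective h)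
      rcases lt_or_gt_of_ne this with h | h
      · simp [hab, h, h.le]
      · simp [hab, h, h.le]
    · simp [hab]
  simp_rw [this]
  rw [← Finset.card_filter]
  have : (Finset.univ.filter fun a : Fin n => a < b) = Finset.Iio b := by ext; simp
  rw [this, Fin.card_Iio]

theorem ascC_rev {n : ℕ} (ρ : Equiv.Perm (Fin n)) :
    ascC (ρ.trans Fin.revPerm) = descC ρ := by
  unfold ascC descC
  simp

theorem fpf_lt {m n : ℕ} (a c : Fin m) (b d : Fin n) :
    (finProdFinEquiv (a, b) < finProdFinEquiv (c, d)) ↔ (a < c ∨ a = c ∧ b < d) := by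
  rw [Fin.lt_def, Fin.lt_def, Fin.lt_def, Fin.ext_iff]
  simp only [finProdFinEquiv_apply_val]
  have hb := b.2
  have hd := d.2
  constructor
  · intro h
    rcases lt_trichotomy a.1 c.1 with h1 | h1 | h1
    · exact Or.inl h1
    · right
      rw [h1] at h
      exact ⟨h1, by omega⟩
    · exfalso
      have := Nat.mul_le_mul_left n (Nat.succ_le_of_lt h1)
      rw [Nat.mul_succ] at this
      omega
  · rintro (h1 | ⟨h1, h2⟩)
    · have := Nat.mul_le_mul_left n (Nat.succ_le_of_lt h1)
      rw [Nat.mul_succ] at this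
      omega
    · rw [h1]; omega

theorem ascC_tensor {m n : ℕ} (σ : Equiv.Perm (Fin m)) (ρ : Equiv.Perm (Fin n)) :
    ascC (tensorPerm σ ρ) = n ^ 2 * ascC σ + m * ascC ρ := by
  have key : ∀ (a c : Fin m) (b d : Fin n),
      (if finProdFinEquiv (a, b) < finProdFinEquiv (c, d) ∧
        tensorPerm σ ρ (finProdFinEquiv (a, b)) < tensorPerm σ ρ (finProdFinEquiv (c, d))
        then 1 else 0 : ℕ) = (if a < c ∧ σ a < σ c then 1 else 0) +
          (if a = c then (if b < d ∧ ρ b < ρ d then 1 else 0) else 0) := by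
    intro a c b d
    have h1 : ∀ x y, tensorPerm σ ρ (finProdFinEquiv (x, y)) = finProdFinEquiv (σ x, ρ y) := by
      intro x y; simp [tensorPerm]
    simp only [h1, fpf_lt]
    rcases eq_or_ne a c with h | h
    · subst h; simp
    · have : σ a ≠ σ c := fun h' => h (σ.injective h')
      simp [h]
  conv_lhs => unfold ascC
  simp only [← (finProdFinEquiv (m := m) (n := n)).sum_comp, Fintype.sum_prod_type, key,
    Finset.sum_add_distrib]
  congr 1
  · unfold ascC
    rw [Finset.mul_sum]
    refine Finset.sum_congr rfl fun a _ => ?_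
    have : ∀ b ∈ (Finset.univ : Finset (Fin n)), (∑ c : Fin m, ∑ _d : Fin n,
        if a < c ∧ σ a < σ c then 1 else 0) =
        n * ∑ c : Fin m, if a < c ∧ σ a < σ c then 1 else 0 := by
      intro b _
      rw [Finset.mul_sum]
      refine Finset.sum_congr rfl fun c _ => ?_
      rw [Finset.sum_const, Finset.card_univ, Fintype.card_fin, smul_eq_mul]
    refine (Finset.sum_congr rfl this).trans ?_
    rw [Finset.sum_const, Finset.card_univ, Fintype.card_fin, smul_eq_mul]
    ring
  · have : ∀ (a : Fin m) (b : Fin n), (∑ c : Fin m, ∑ d : Fin n,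
        if a = c then (if b < d ∧ ρ b < ρ d then 1 else 0) else 0)
        = ∑ d : Fin n, (if b < d ∧ ρ b < ρ d then 1 else 0) := by
      intro a b
      rw [Finset.sum_comm]
      simp
    simp only [this]
    simp only [Finset.sum_const, Finset.card_univ, Fintype.card_fin, smul_eq_mul]
    rfl

/-- The key closeness estimate. -/
theorem exists_good {m : ℕ} (σ : Equiv.Perm (Fin m)) (h : IsKInflatable σ 2) (ε : ℝ)
    (hε : 0 < ε) : ∀ᶠ n : ℕ in Filter.atTop, ∃ ρ : Equiv.Perm (Fin n),
      |(4 : ℝ) * (ascC (tensorPerm σ ρ) : ℝ) / ((m * n : ℕ) : ℝ) ^ 2 - 1| ≤ ε ∧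
      |(4 : ℝ) * (ascC (tensorPerm σ (ρ.trans Fin.revPerm)) : ℝ) /
        ((m * n : ℕ) : ℝ) ^ 2 - 1| ≤ ε := by
  classical
  have h2 := h.2 (Equiv.refl _) ε hε
  filter_upwards [h2.eventually (gt_mem_nhds (show (0 : ℝ) < 1 / 2 by norm_num))] with n hn
  have hf : ((Nat.factorial 2 : ℕ) : ℝ) ^ 2 = 4 := by norm_num [Nat.factorial]
  simp only [patternCount_refl_eq, hf] at hn
  by_contra! hcon
  set P : Equiv.Perm (Fin n) → Prop := fun ρ =>
    ε < |(4 : ℝ) * (ascC (tensorPerm σ ρ) : ℝ) / ((m * n : ℕ) : ℝ) ^ 2 - 1| with hP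
  have hn' : ((Finset.univ.filter P).card : ℝ) / (Fintype.card (Equiv.Perm (Fin n)) : ℝ) < 1 / 2 := by
    convert hn
  have hpos : (0 : ℝ) < Fintype.card (Equiv.Perm (Fin n)) := by
    exact_mod_cast Fintype.card_pos
  rw [div_lt_iff₀ hpos] at hn'
  have hcov : (Finset.univ : Finset (Equiv.Perm (Fin n))) ⊆ Finset.univ.filter P ∪
      (Finset.univ.filter fun ρ => P (ρ.trans Fin.revPerm)) := by
    intro ρ _
    simp only [Finset.mem_union, Finset.mem_filter, Finset.mem_univ, true_and]
    by_cases hp : P ρ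
    · exact Or.inl hp
    · exact Or.inr (hcon ρ (not_lt.mp hp))
  have hcard : (Finset.univ.filter fun ρ : Equiv.Perm (Fin n) => P (ρ.trans Fin.revPerm)).card ≤
      (Finset.univ.filter P).card := by
    apply Finset.card_le_card_of_injOn (fun ρ => ρ.trans Fin.revPerm)
    · intro ρ hρ
      simpa using hρ
    · intro x _ y _ hxy
      ext i
      have := congrArg (fun e : Equiv.Perm (Fin n) => e i) hxy
      simp at this
      rw [this]
  have := (Finset.card_le_card hcov).trans (Finset.card_union_le _ _)
  rw [Finset.card_univ] at this
  have h3 : (Fintype.card (Equiv.Perm (Fin n)) : ℝ) ≤ (Finset.univ.filter P).card +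
      (Finset.univ.filter P).card := by
    exact_mod_cast this.trans (Nat.add_le_add_left hcard _)
  linarith

theorem stmt14 {m : ℕ} (σ : Equiv.Perm (Fin m)) (h : IsKInflatable σ 2) :
    (patternCount σ (Equiv.refl (Fin 2)) : ℚ) = m * (m - 1) / 4 ∧
      (patternCount σ (Equiv.swap (0 : Fin 2) 1) : ℚ) = m * (m - 1) / 4 := by
  rw [patternCount_refl_eq, patternCount_swap_eq]
  have hm : m ≠ 0 := by
    rintro rfl
    have := h.1.eventually (Filter.eventually_ge_atTop 1)
    simp only [zero_mul] at this
    obtain ⟨a, ha⟩ := Filter.eventually_atTop.mp this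
    have := ha a le_rfl
    omega
  have hm0 : (m : ℝ) ≠ 0 := by exact_mod_cast hm
  have lim1 : Filter.Tendsto (fun n : ℕ =>
      |8 * (ascC σ : ℝ) / (m : ℝ) ^ 2 + 2 / m * (1 - 1 / (n : ℝ)) - 2|) Filter.atTop
      (nhds |8 * (ascC σ : ℝ) / (m : ℝ) ^ 2 + 2 / m * (1 - 0) - 2|) := by
    have := tendsto_one_div_atTop_nhds_zero_nat (𝕜 := ℝ)
    exact (((this.const_sub 1).const_mul _).const_add _ |>.sub_const _).abs
  have hle : ∀ ε : ℝ, 0 < ε →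
      |8 * (ascC σ : ℝ) / (m : ℝ) ^ 2 + 2 / m * (1 - 0) - 2| ≤ 0 + 2 * ε := by
    intro ε hε
    refine le_of_tendsto lim1 ?_
    filter_upwards [exists_good σ h ε hε, Filter.eventually_ge_atTop 1] with n ⟨ρ, h1, h2⟩ hn
    have hn0 : (n : ℝ) ≠ 0 := by
      have : n ≠ 0 := by omega
      exact_mod_cast this
    rw [ascC_tensor] at h1 h2
    rw [ascC_rev] at h2
    have h3 := ascC_add_descC ρ
    have h4 : ((ascC ρ : ℝ) + descC ρ) * 2 = n * (n - 1) := by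
      have := congrArg (fun x : ℕ => (x : ℝ)) h3
      push_cast [hn] at this
      exact this
    have h5 := (abs_add_le _ _).trans (add_le_add h1 h2)
    have h6 : 8 * (ascC σ : ℝ) / (m : ℝ) ^ 2 + 2 / m * (1 - 1 / (n : ℝ)) - 2 =
        (4 : ℝ) * ((n ^ 2 * ascC σ + m * ascC ρ : ℕ) : ℝ) / ((m * n : ℕ) : ℝ) ^ 2 - 1 +
        ((4 : ℝ) * ((n ^ 2 * ascC σ + m * descC ρ : ℕ) : ℝ) / ((m * n : ℕ) : ℝ) ^ 2 - 1) := by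
      push_cast
      have : (descC ρ : ℝ) = n * (n - 1) / 2 - ascC ρ := by linarith
      rw [this]
      field_simp
      ring
    rw [h6]
    linarith
  have hz : |8 * (ascC σ : ℝ) / (m : ℝ) ^ 2 + 2 / m * (1 - 0) - 2| ≤ 0 := by
    refine le_of_forall_pos_le_add fun ε hε => ?_
    have := hle (ε / 2) (by linarith)
    linarith
  have hz' := abs_nonpos_iff.mp hz
  have hA : (ascC σ : ℝ) = m * (m - 1) / 4 := by
    field_simp at hz'
    linarith
  have hAq : (ascC σ : ℚ) = m * (m - 1) / 4 := by
    have : ((ascC σ : ℚ) : ℝ) = ((m * (m - 1) / 4 : ℚ) : ℝ) := by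
      push_cast; exact hA
    exact_mod_cast this
  refine ⟨hAq, ?_⟩
  have h3 := ascC_add_descC σ
  have hm1 : 1 ≤ m := by omega
  have h4 : ((ascC σ : ℚ) + descC σ) * 2 = m * (m - 1) := by
    have := congrArg (fun x : ℕ => (x : ℚ)) h3
    push_cast [hm1] at this
    exact this
  linarith
end
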